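/- (Any two points of a complete spacetime are joined by a single forward 'tent'.) Let T > 0 and let (𝓜, u) be a complete conformal Ricci flow spacetime in the ambient space ℂ × (0,T). Then for any (x,t), (x′,t′) ∈ 𝓜 there exist (y,τ) ∈ 𝓜 with τ ≥ max(t,t′) and continuous maps η : [t,τ] → ℂ and γ : [t′,τ] → ℂ such that (η(r),r) ∈ 𝓜 for all r ∈ [t,τ], (γ(r),r) ∈ 𝓜 for all r ∈ [t′,τ], η(t) = x, γ(t′) = x′, and η(τ) = γ(τ) = y. -/

import Mathlib

open Set MeasureTheory Filter Metric

/-- The Euclidean Laplacian of `f : ℂ → ℝ` at `z`, i.e. `∂²f/∂x² + ∂²f/∂y²`. -/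
noncomputable def lap (f : ℂ → ℝ) (z : ℂ) : ℝ :=
  iteratedFDeriv ℝ 2 f z ![1, 1] + iteratedFDeriv ℝ 2 f z ![Complex.I, Complex.I]

/-- The time-timeSlice of a spacetime `M ⊆ ℂ × ℝ` at time `t`. -/
def timeSlice (M : Set (ℂ × ℝ)) (t : ℝ) : Set ℂ := {z | (z, t) ∈ M}

/-- The conformal distance on `Ω` induced by a conformal factor `v`: the infimum of
`v`-lengths of `C¹` paths in `Ω` joining `x` to `y`. -/
noncomputable def confDist (v : ℂ → ℝ) (Ω : Set ℂ) (x y : ℂ) : ℝ :=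
  sInf {L : ℝ | ∃ γ : ℝ → ℂ, ContDiffOn ℝ 1 γ (Icc 0 1) ∧
    (∀ s ∈ Icc (0:ℝ) 1, γ s ∈ Ω) ∧ γ 0 = x ∧ γ 1 = y ∧
    L = ∫ s in (0:ℝ)..1, Real.sqrt (v (γ s)) * ‖derivWithin γ (Icc 0 1) s‖}

/-- The conformal ball of centre `p` and radius `ρ` in `Ω` for the metric `v|dz|²`. -/
def confBall (v : ℂ → ℝ) (Ω : Set ℂ) (p : ℂ) (ρ : ℝ) : Set ℂ :=
  {z ∈ connectedComponentIn Ω p | confDist v Ω p z < ρ}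

/-- The conformal metric `v|dz|²` is complete on `Ω`: every connected component of `Ω` is a
complete metric space with respect to the induced distance `confDist v Ω`. -/
def ConfComplete (v : ℂ → ℝ) (Ω : Set ℂ) : Prop :=
  ∀ x₀ ∈ Ω, ∀ x : ℕ → ℂ, (∀ n, x n ∈ connectedComponentIn Ω x₀) →
    (∀ ε : ℝ, 0 < ε → ∃ N : ℕ, ∀ m ≥ N, ∀ n ≥ N, confDist v Ω (x m) (x n) < ε) →
    ∃ l ∈ connectedComponentIn Ω x₀,
      Tendsto (fun n => confDist v Ω (x n) l) atTop (nhds 0)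

/-- A conformal Ricci flow spacetime in the ambient space `ℂ × (0,T)`:
`M` is a connected open subset of `ℂ × (0,T)` with non-empty time-slices, and `u` is a smooth
positive conformal factor on `M` solving the logarithmic fast diffusion equation
`∂u/∂t = Δ log u`. -/
structure ConfRFS (T : ℝ) (M : Set (ℂ × ℝ)) (u : ℂ → ℝ → ℝ) : Prop where
  sub : M ⊆ {p : ℂ × ℝ | p.2 ∈ Ioo 0 T}
  opn : IsOpen M
  conn : IsConnected M
  nonempty : ∀ t ∈ Ioo (0:ℝ) T, (timeSlice M t).Nonempty
  pos : ∀ p ∈ M, 0 < u p.1 p.2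
  smooth : ContDiffOn ℝ (⊤ : ℕ∞) (fun p : ℂ × ℝ => u p.1 p.2) M
  lfde : ∀ p ∈ M, deriv (u p.1) p.2 = lap (fun z => Real.log (u z p.2)) p.1

/-- A conformal Ricci flow spacetime is complete if the metric `u(·,t)|dz|²` is complete on the
timeSlice `M_t` for every `t ∈ (0,T)`. -/
def ConfRFSComplete (T : ℝ) (M : Set (ℂ × ℝ)) (u : ℂ → ℝ → ℝ) : Prop :=
  ∀ t ∈ Ioo (0:ℝ) T, ConfComplete (fun z => u z t) (timeSlice M t)

/-- There is a time-preserving path in `M` from time `s` to the point `(z,t)`. -/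
def TimePreservingFrom (M : Set (ℂ × ℝ)) (s : ℝ) (z : ℂ) (t : ℝ) : Prop :=
  ∃ γ : ℝ → ℂ, ContinuousOn γ (Icc s t) ∧ (∀ r ∈ Icc s t, (γ r, r) ∈ M) ∧ γ t = z

/-- The hindsight function of a spacetime `M`. -/
noncomputable def hindsight (M : Set (ℂ × ℝ)) (z : ℂ) (t : ℝ) : ℝ :=
  sInf {s : ℝ | 0 < s ∧ s ≤ t ∧ TimePreservingFrom M s z t}

/-- A spacetime is initially determined if its hindsight function vanishes identically. -/
def InitiallyDetermined (M : Set (ℂ × ℝ)) : Prop :=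
  ∀ p ∈ M, hindsight M p.1 p.2 = 0

/-- A spacetime in `ℂ × (0,T)` is expanding if worldlines persist until the final time. -/
def Expanding (T : ℝ) (M : Set (ℂ × ℝ)) : Prop :=
  ∀ (z : ℂ) (t t' : ℝ), (z, t) ∈ M → t ≤ t' → t' < T → (z, t') ∈ M

/-- An expanding spacetime is continuous if each timeSlice is the interior of the intersection of
all later slices. -/
def ContinuousSpacetime (T : ℝ) (M : Set (ℂ × ℝ)) : Prop :=
  ∀ s ∈ Ioo (0:ℝ) T, timeSlice M s = interior (⋂ t ∈ Ioo s T, timeSlice M t)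

/-- The vanishing time of the point `(z,t)`: the supremum of the connected component containing
`t` of the set of times at which `z` belongs to the spacetime. -/
noncomputable def vanishTime (M : Set (ℂ × ℝ)) (z : ℂ) (t : ℝ) : ℝ :=
  sSup (connectedComponentIn {r : ℝ | (z, r) ∈ M} t)

/-- Points of a connected component of an open set are joined by smooth paths in that set. -/
lemma exists_contDiff_path {Ω : Set ℂ} (hΩ : IsOpen Ω) {x y : ℂ} (hx : x ∈ Ω)
    (hy : y ∈ connectedComponentIn Ω x) :
    ∃ γ : ℝ → ℂ, ContDiff ℝ 1 γ ∧ (∀ s, γ s ∈ Ω) ∧ γ 0 = x ∧ γ 1 = y := by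
  let R : Set ℂ := {y | ∃ γ : ℝ → ℂ, ContDiff ℝ 1 γ ∧ (∀ s, γ s ∈ Ω) ∧ (∀ s ≤ 0, γ s = x) ∧
    ∀ s, 1 ≤ s → γ s = y}
  have step : ∀ a ∈ R, ∀ b, ∀ r > 0, ball b r ⊆ Ω → a ∈ ball b r → ∀ a' ∈ ball b r, a' ∈ R := by
    rintro a ⟨γ, hγ, hγΩ, h0, h1⟩ b r hr hball ha a' ha'
    refine ⟨fun s => γ (2 * s) + Real.smoothTransition (2 * s - 1) • (a' - a), ?_, ?_, ?_, ?_⟩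
    · have h2 : ContDiff ℝ 1 (fun s : ℝ => Real.smoothTransition (2 * s - 1)) :=
        Real.smoothTransition.contDiff.comp (by fun_prop)
      exact (hγ.comp (by fun_prop)).add (h2.smul contDiff_const)
    · intro s
      rcases le_total s (1 / 2) with hs | hs
      · simp only [Real.smoothTransition.zero_of_nonpos (show 2 * s - 1 ≤ 0 by linarith),
          zero_smul, add_zero]
        exact hγΩ _
      · simp only [h1 (2 * s) (by linarith)]
        exact hball ((convex_ball b r).add_smul_sub_mem ha ha'
          ⟨Real.smoothTransition.nonneg _, Real.smoothTransition.le_one _⟩)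
    · intro s hs
      simp [Real.smoothTransition.zero_of_nonpos (show 2 * s - 1 ≤ 0 by linarith),
        h0 (2 * s) (by linarith)]
    · intro s hs
      simp [Real.smoothTransition.one_of_one_le (show 1 ≤ 2 * s - 1 by linarith),
        h1 (2 * s) (by linarith)]
  have hxR : x ∈ R := ⟨fun _ => x, contDiff_const, fun _ => hx, fun _ _ => rfl, fun _ _ => rfl⟩
  have hRΩ : R ⊆ Ω := by
    rintro a ⟨γ, -, h, -, h1⟩
    exact h1 1 le_rfl ▸ h 1
  have hRo : IsOpen R := by
    rw [Metric.isOpen_iff]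
    intro a ha
    obtain ⟨r, hr, hb⟩ := Metric.isOpen_iff.1 hΩ a (hRΩ ha)
    exact ⟨r, hr, fun a' ha' => step a ha a r hr hb (mem_ball_self hr) a' ha'⟩
  have hsub : connectedComponentIn Ω x ⊆ R := by
    refine isPreconnected_connectedComponentIn.subset_of_closure_inter_subset hRo
      ⟨x, mem_connectedComponentIn hx, hxR⟩ ?_
    rintro a ⟨ha, haC⟩
    obtain ⟨r, hr, hb⟩ := Metric.isOpen_iff.1 hΩ a (connectedComponentIn_subset _ _ haC)
    obtain ⟨b, hbR, hab⟩ := Metric.mem_closure_iff.1 ha r hr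
    exact step b hbR a r hr hb (by rwa [mem_ball, dist_comm]) a (mem_ball_self hr)
  obtain ⟨γ, hγ, h, h0, h1⟩ := hsub hy
  exact ⟨γ, hγ, h, h0 0 le_rfl, h1 1 le_rfl⟩

/-- A path leaving a ball on which the conformal factor is bounded below is long. -/
lemma le_length_of_mem_ball {Ω : Set ℂ} {v : ℂ → ℝ} (hv : ContinuousOn v Ω)
    {l : ℂ} {δ κ : ℝ} (hκ0 : 0 ≤ κ) (hκ : ∀ z ∈ ball l δ, κ ≤ Real.sqrt (v z))
    {γ : ℝ → ℂ} (hγ : ContDiffOn ℝ 1 γ (Icc 0 1)) (hγΩ : ∀ s ∈ Icc (0:ℝ) 1, γ s ∈ Ω)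
    (h0 : δ ≤ ‖γ 0 - l‖) (h1 : γ 1 = l) :
    κ * δ ≤ ∫ s in (0:ℝ)..1, Real.sqrt (v (γ s)) * ‖derivWithin γ (Icc 0 1) s‖ := by
  have hγc := hγ.continuousOn
  have hdc : ContinuousOn (derivWithin γ (Icc 0 1)) (Icc 0 1) :=
    hγ.continuousOn_derivWithin (uniqueDiffOn_Icc zero_lt_one) le_rfl
  have hint : ContinuousOn (fun s => Real.sqrt (v (γ s)) * ‖derivWithin γ (Icc 0 1) s‖)
      (Icc 0 1) :=
    (Real.continuous_sqrt.comp_continuousOn (hv.comp hγc hγΩ)).mul hdc.norm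
  have hcomp : IsCompact {s ∈ Icc (0:ℝ) 1 | δ ≤ ‖γ s - l‖} :=
    isCompact_Icc.of_isClosed_subset
      (((hγc.sub continuousOn_const).norm).preimage_isClosed_of_isClosed isClosed_Icc
        (isClosed_Ici (a := δ))) (fun s hs => hs.1)
  obtain ⟨t, ⟨ht, htδ⟩, htmax⟩ := hcomp.exists_isGreatest ⟨0, by simp, h0⟩
  have hsub : Icc t 1 ⊆ Icc (0:ℝ) 1 := Icc_subset_Icc_left ht.1
  have hball : ∀ s ∈ Ioo t 1, γ s ∈ ball l δ := by
    intro s hs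
    by_contra hcon
    rw [mem_ball, dist_eq_norm, not_lt] at hcon
    exact absurd (htmax ⟨hsub (Ioo_subset_Icc_self hs), hcon⟩) (not_le.2 hs.1)
  have hI1 : IntervalIntegrable (fun s => Real.sqrt (v (γ s)) * ‖derivWithin γ (Icc 0 1) s‖)
      volume 0 1 :=
    (hint.mono (uIcc_of_le zero_le_one).le).intervalIntegrable
  have hI2 : IntervalIntegrable (fun s => Real.sqrt (v (γ s)) * ‖derivWithin γ (Icc 0 1) s‖)
      volume t 1 :=
    (hint.mono ((uIcc_of_le ht.2).le.trans hsub)).intervalIntegrable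
  have hI3 : IntervalIntegrable (derivWithin γ (Icc 0 1)) volume t 1 :=
    (hdc.mono ((uIcc_of_le ht.2).le.trans hsub)).intervalIntegrable
  have hftc : ∫ s in t..1, derivWithin γ (Icc 0 1) s = γ 1 - γ t := by
    refine intervalIntegral.integral_eq_sub_of_hasDerivAt_of_le ht.2 (hγc.mono hsub) ?_ hI3
    intro s hs
    have hs' : s ∈ Ioo (0:ℝ) 1 := ⟨ht.1.trans_lt hs.1, hs.2⟩
    exact ((hγ.differentiableOn one_ne_zero s (Ioo_subset_Icc_self hs')).hasDerivWithinAt).hasDerivAt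
      (Icc_mem_nhds hs'.1 hs'.2)
  calc κ * δ ≤ κ * ‖∫ s in t..1, derivWithin γ (Icc 0 1) s‖ := by
        rw [hftc, h1, norm_sub_rev]
        exact mul_le_mul_of_nonneg_left htδ hκ0
    _ ≤ κ * ∫ s in t..1, ‖derivWithin γ (Icc 0 1) s‖ :=
        mul_le_mul_of_nonneg_left (intervalIntegral.norm_integral_le_integral_norm ht.2) hκ0
    _ = ∫ s in t..1, κ * ‖derivWithin γ (Icc 0 1) s‖ := by
        rw [intervalIntegral.integral_const_mul]
    _ ≤ ∫ s in t..1, Real.sqrt (v (γ s)) * ‖derivWithin γ (Icc 0 1) s‖ :=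
        intervalIntegral.integral_mono_on_of_le_Ioo ht.2 (hI3.norm.const_mul κ) hI2
          fun s hs => mul_le_mul_of_nonneg_right (hκ _ (hball s hs)) (norm_nonneg _)
    _ ≤ _ := intervalIntegral.integral_mono_interval ht.1 ht.2 le_rfl
        (Eventually.of_forall fun s => by positivity) hI1

lemma confDist_le {Ω : Set ℂ} {v : ℂ → ℝ} {γ : ℝ → ℂ} (hγ : ContDiffOn ℝ 1 γ (Icc 0 1))
    (hγΩ : ∀ s ∈ Icc (0:ℝ) 1, γ s ∈ Ω) :
    confDist v Ω (γ 0) (γ 1) ≤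
      ∫ s in (0:ℝ)..1, Real.sqrt (v (γ s)) * ‖derivWithin γ (Icc 0 1) s‖ := by
  refine csInf_le ⟨0, ?_⟩ ⟨γ, hγ, hγΩ, rfl, rfl, rfl⟩
  rintro L ⟨γ', -, -, -, -, rfl⟩
  exact intervalIntegral.integral_nonneg zero_le_one fun s _ => by positivity

/-- A complete conformal metric whose factor grows at most like the inverse of the distance along a
half-open segment contains the endpoint of that segment. -/
lemma ConfComplete.endpoint_mem {Ω : Set ℂ} (hΩ : IsOpen Ω) {v : ℂ → ℝ} (hv : ContinuousOn v Ω)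
    (hpos : ∀ z ∈ Ω, 0 < v z) (hc : ConfComplete v Ω) {z e : ℂ} {C : ℝ}
    (hseg : ∀ q ∈ Ioc (0:ℝ) 1, z - (q ^ 2) • e ∈ Ω)
    (hC : ∀ q ∈ Ioc (0:ℝ) 1, Real.sqrt (v (z - (q ^ 2) • e)) * q ≤ C) : z ∈ Ω := by
  set p : ℝ → ℂ := fun q => z - (q ^ 2) • e with hp
  have hpc : Continuous p := by fun_prop
  set Q : ℕ → ℝ := fun n => 1 / ((n : ℝ) + 1) with hQ
  have hQmem : ∀ n, Q n ∈ Ioc (0:ℝ) 1 := fun n =>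
    ⟨by positivity, by rw [hQ]; simp only; rw [div_le_one (by positivity)]; simp⟩
  have hQlim : Tendsto Q atTop (nhds 0) := tendsto_one_div_add_atTop_nhds_zero_nat
  have hpre : p '' Ioc 0 1 ⊆ connectedComponentIn Ω (p 1) :=
    (isPreconnected_Ioc.image p hpc.continuousOn).subset_connectedComponentIn
      (mem_image_of_mem p (by simp)) (by rintro _ ⟨q, hq, rfl⟩; exact hseg q hq)
  have hcc : ∀ n, p (Q n) ∈ connectedComponentIn Ω (p 1) := fun n => hpre ⟨_, hQmem n, rfl⟩
  have hC0 : 0 ≤ C := le_trans (by positivity) (hC 1 (by simp))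
  have hdist : ∀ a ∈ Ioc (0:ℝ) 1, ∀ b ∈ Ioc (0:ℝ) 1,
      confDist v Ω (p a) (p b) ≤ 2 * C * ‖e‖ * |b - a| := by
    intro a ha b hb
    set σ : ℝ → ℝ := fun s => a + s * (b - a) with hσ
    have hσm : ∀ s ∈ Icc (0:ℝ) 1, σ s ∈ Ioc (0:ℝ) 1 := fun s hs =>
      (convex_Ioc (0:ℝ) 1).add_smul_sub_mem ha hb hs
    have hd : ∀ s, HasDerivAt (fun s => p (σ s)) (-((2 * σ s * (b - a)) • e)) s := by
      intro s
      have h1 : HasDerivAt σ (b - a) s := 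
        (((hasDerivAt_id s).mul_const (b - a)).const_add a).congr_deriv (one_mul _)
      have h2 := ((h1.pow 2).smul_const e).const_sub z
      exact h2.congr_deriv (by simp)
    have hcd : ContDiff ℝ 1 (fun s => p (σ s)) := by
      simp only [hp, hσ]
      fun_prop
    have hle := confDist_le (v := v) hcd.contDiffOn (fun s hs => hseg _ (hσm s hs))
    have e0 : σ 0 = a := by simp [hσ]
    have e1 : σ 1 = b := by simp [hσ]
    simp only [e0, e1] at hle
    refine hle.trans ((le_abs_self _).trans ?_)
    have hb := intervalIntegral.norm_integral_le_of_norm_le_const (a := 0) (b := 1)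
      (C := 2 * C * ‖e‖ * |b - a|)
      (f := fun s => Real.sqrt (v (p (σ s))) * ‖derivWithin (fun s => p (σ s)) (Icc 0 1) s‖) ?_
    · simpa using hb
    intro s hs
    rw [uIoc_of_le zero_le_one] at hs
    have hs' := Ioc_subset_Icc_self hs
    rw [(hd s).hasDerivWithinAt.derivWithin (uniqueDiffOn_Icc zero_lt_one s hs'),
      Real.norm_of_nonneg (by positivity), norm_neg, norm_smul, Real.norm_eq_abs, abs_mul, abs_mul,
      abs_of_pos (hσm s hs').1, abs_two]
    have := mul_le_mul_of_nonneg_right (hC _ (hσm s hs'))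
      (show 0 ≤ 2 * |b - a| * ‖e‖ by positivity)
    calc _ = Real.sqrt (v (z - (σ s ^ 2) • e)) * σ s * (2 * |b - a| * ‖e‖) := by
          simp only [hp]; ring
      _ ≤ _ := this
      _ = _ := by ring
  obtain ⟨l, hl, hlim⟩ := hc (p 1) (hseg 1 (by simp)) (fun n => p (Q n)) hcc (by
    intro ε hε
    have hcau := hQlim.cauchySeq
    rw [Metric.cauchySeq_iff] at hcau
    obtain ⟨N, hN⟩ := hcau (ε / (2 * C * ‖e‖ + 1)) (by positivity)
    refine ⟨N, fun m hm n hn => ?_⟩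
    have h1 := hN n hn m hm
    rw [Real.dist_eq, lt_div_iff₀ (by positivity)] at h1
    have h2 := hdist _ (hQmem m) _ (hQmem n)
    nlinarith [abs_nonneg (Q n - Q m)])
  by_contra hz
  have hlΩ := connectedComponentIn_subset _ _ hl
  have hne : 0 < ‖z - l‖ := norm_pos_iff.2 (sub_ne_zero.2 fun h => hz (h ▸ hlΩ))
  obtain ⟨δ₁, hδ₁, hball⟩ := Metric.eventually_nhds_iff_ball.1
    ((hv.continuousAt (hΩ.mem_nhds hlΩ)).eventually
      (lt_mem_nhds (show v l / 2 < v l by linarith [hpos l hlΩ])))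
  set δ := min δ₁ (‖z - l‖ / 2) with hδ
  have hδ0 : 0 < δ := lt_min hδ₁ (by positivity)
  set κ := Real.sqrt (v l / 2) with hκ
  have hκ0 : 0 < κ := Real.sqrt_pos.2 (by linarith [hpos l hlΩ])
  have hfar : ∀ᶠ n in atTop, δ < ‖p (Q n) - l‖ := by
    have h1 : Tendsto (fun n => ‖p (Q n) - l‖) atTop (nhds ‖p 0 - l‖) :=
      (((hpc.tendsto 0).comp hQlim).sub_const l).norm
    refine h1.eventually (lt_mem_nhds ?_)
    have : δ ≤ ‖z - l‖ / 2 := min_le_right _ _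
    simp only [hp]
    simp
    linarith
  obtain ⟨n, hn1, hn2⟩ := (hfar.and (hlim.eventually
    (gt_mem_nhds (show 0 < κ * δ by positivity)))).exists
  refine absurd hn2 (not_lt.2 ?_)
  obtain ⟨γ, hγ, hγΩ, h0, h1⟩ := exists_contDiff_path hΩ
    (connectedComponentIn_subset _ _ (hcc n)) (connectedComponentIn_eq (hcc n) ▸ hl)
  refine le_csInf ⟨_, γ, hγ.contDiffOn, fun s _ => hγΩ s, h0, h1, rfl⟩ ?_
  rintro L ⟨γ', hγ', hγΩ', h0', h1', rfl⟩
  refine le_length_of_mem_ball hv hκ0.le (fun y hy => ?_) hγ' hγΩ' (h0' ▸ hn1.le) h1'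
  exact Real.sqrt_le_sqrt (hball y (ball_subset_ball (min_le_left _ _) hy)).le

lemma deriv_deriv_nonpos_of_isLocalMax {φ : ℝ → ℝ} {x : ℝ} (hmax : IsLocalMax φ x)
    (hc : ContinuousAt φ x) : deriv (deriv φ) x ≤ 0 := by
  by_contra! h
  have hmin := isLocalMin_of_deriv_deriv_pos h hmax.deriv_eq_zero hc
  have heq : φ =ᶠ[nhds x] fun _ => φ x := by
    filter_upwards [hmax, hmin] with y h1 h2 using le_antisymm h1 h2
  have h2 := heq.deriv.deriv_eq
  simp at h2
  exact h.ne' h2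

/-- The second derivative test along a line for a sum of a function of `z` and a function of the
line parameter. -/
lemma iteratedFDeriv_two_add_nonpos {F : ℂ → ℝ} {z v : ℂ} (hF : ContDiffAt ℝ 2 F z)
    {G G' : ℝ → ℝ} {G'' : ℝ} (hG : ∀ᶠ s in nhds (0:ℝ), HasDerivAt G (G' s) s)
    (hG' : HasDerivAt G' G'' 0) (hmax : IsLocalMax (fun s : ℝ => F (z + s • v) + G s) 0) :
    iteratedFDeriv ℝ 2 F z ![v, v] + G'' ≤ 0 := by
  have hline : ∀ s : ℝ, HasDerivAt (fun s : ℝ => z + s • v) v s := fun s =>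
    (((hasDerivAt_id s).smul_const v).const_add z).congr_deriv (one_smul _ _)
  have htend : Tendsto (fun s : ℝ => z + s • v) (nhds 0) (nhds z) := by
    simpa using (hline 0).continuousAt.tendsto
  have hF1 : ∀ᶠ s in nhds (0:ℝ), HasDerivAt (fun s : ℝ => F (z + s • v) + G s)
      (fderiv ℝ F (z + s • v) v + G' s) s := by
    filter_upwards [htend.eventually (hF.eventually (by simp)), hG] with s hs hs'
    exact ((hs.differentiableAt (by simp)).hasFDerivAt.comp_hasDerivAt s (hline s)).add hs'
  have hF2 : HasDerivAt (fun s : ℝ => fderiv ℝ F (z + s • v) v + G' s)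
      (fderiv ℝ (fderiv ℝ F) z v v + G'') 0 := by
    have h1 : HasFDerivAt (fderiv ℝ F) (fderiv ℝ (fderiv ℝ F) z) (z + (0:ℝ) • v) := by
      rw [zero_smul, add_zero]
      exact ((hF.fderiv_right (m := 1) (by norm_num)).differentiableAt one_ne_zero).hasFDerivAt
    have h2 : HasDerivAt (fun s : ℝ => fderiv ℝ F (z + s • v)) (fderiv ℝ (fderiv ℝ F) z v) 0 :=
      h1.comp_hasDerivAt (0:ℝ) (hline 0)
    have h3 : HasDerivAt (fun s : ℝ => fderiv ℝ F (z + s • v) v) (fderiv ℝ (fderiv ℝ F) z v v) 0 :=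
      (ContinuousLinearMap.apply ℝ ℝ v).hasFDerivAt.comp_hasDerivAt (0:ℝ) h2
    exact h3.add hG'
  have h := deriv_deriv_nonpos_of_isLocalMax hmax hF1.self_of_nhds.continuousAt
  have heq : deriv (fun s : ℝ => F (z + s • v) + G s) =ᶠ[nhds 0]
      fun s : ℝ => fderiv ℝ F (z + s • v) v + G' s := hF1.mono fun s hs => hs.deriv
  rw [heq.deriv_eq, hF2.deriv] at h
  rw [iteratedFDeriv_two_apply]
  simpa using h

/-- The Laplacian of `F` at a local maximum of `F + log (ρ² - |· - z₀|²)`. -/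
lemma lap_le_of_isLocalMax {F : ℂ → ℝ} {z z₀ : ℂ} {ρ : ℝ} (hF : ContDiffAt ℝ 2 F z)
    (hz : ‖z - z₀‖ ^ 2 < ρ ^ 2)
    (hmax : IsLocalMax (fun y => F y + Real.log (ρ ^ 2 - ‖y - z₀‖ ^ 2)) z) :
    lap F z ≤ 4 * ρ ^ 2 / (ρ ^ 2 - ‖z - z₀‖ ^ 2) ^ 2 := by
  set a := ρ ^ 2 - ‖z - z₀‖ ^ 2 with ha
  have ha0 : 0 < a := by linarith
  have key : ∀ (v : ℂ) (b : ℝ), (∀ s : ℝ, ‖z + s • v - z₀‖ ^ 2 = ‖z - z₀‖ ^ 2 + b * s + s ^ 2) →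
      iteratedFDeriv ℝ 2 F z ![v, v] + (-2 * a - b ^ 2) / a ^ 2 ≤ 0 := by
    intro v b hb
    have hD : ∀ s : ℝ, HasDerivAt (fun s : ℝ => a - b * s - s ^ 2) (-b - 2 * s) s := by
      intro s
      refine ((((hasDerivAt_id s).const_mul b).const_sub a).sub
        ((hasDerivAt_id s).pow 2)).congr_deriv ?_
      simp
    have hN : HasDerivAt (fun s : ℝ => -b - 2 * s) (-2) 0 :=
      (((hasDerivAt_id (0:ℝ)).const_mul 2).const_sub (-b)).congr_deriv (by simp)
    have hpos : ∀ᶠ s in nhds (0:ℝ), 0 < a - b * s - s ^ 2 :=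
      (hD 0).continuousAt.eventually (lt_mem_nhds (by simpa using ha0))
    refine iteratedFDeriv_two_add_nonpos hF (G := fun s => Real.log (a - b * s - s ^ 2))
      (G' := fun s => (-b - 2 * s) / (a - b * s - s ^ 2))
      (hpos.mono fun s hs => (hD s).log hs.ne')
      ((hN.div (hD 0) (by simpa using ha0.ne')).congr_deriv ?_) ?_
    · congr 1 <;> ring
    · have hline : Tendsto (fun s : ℝ => z + s • v) (nhds 0) (nhds z) :=
        Continuous.tendsto' (by fun_prop) _ _ (by simp)
      have hrw : ∀ s : ℝ, a - b * s - s ^ 2 = ρ ^ 2 - ‖z + s • v - z₀‖ ^ 2 := fun s => by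
        rw [hb, ha]; ring
      filter_upwards [hline.eventually hmax] with s hs
      simpa only [hrw, zero_smul, add_zero] using hs
  have h1 := key 1 (2 * (z - z₀).re) (by
    intro s
    simp only [Complex.sq_norm, Complex.normSq_apply]
    simp
    ring)
  have h2 := key Complex.I (2 * (z - z₀).im) (by
    intro s
    simp only [Complex.sq_norm, Complex.normSq_apply]
    simp
    ring)
  have h3 : ‖z - z₀‖ ^ 2 = (z - z₀).re ^ 2 + (z - z₀).im ^ 2 := by
    rw [Complex.sq_norm, Complex.normSq_apply]; ring
  have h4 : 4 * ρ ^ 2 / a ^ 2 =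
      -((-2 * a - (2 * (z - z₀).re) ^ 2) / a ^ 2 + (-2 * a - (2 * (z - z₀).im) ^ 2) / a ^ 2) := by
    rw [← add_div, ← neg_div]
    congr 1
    rw [ha, h3]; ring
  rw [h4, lap]
  linarith

lemma HasDerivAt.nonneg_of_eventually_le_left {f : ℝ → ℝ} {f' t : ℝ} (hf : HasDerivAt f f' t)
    (h : ∀ᶠ s in nhdsWithin t (Iio t), f s ≤ f t) : 0 ≤ f' := by
  have h1 : Tendsto (slope f t) (nhdsWithin t (Iio t)) (nhds f') :=
    (hasDerivAt_iff_tendsto_slope.1 hf).mono_left (nhdsWithin_mono t fun s hs => ne_of_lt hs)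
  refine ge_of_tendsto h1 ?_
  filter_upwards [h, self_mem_nhdsWithin] with s hs hst
  rw [slope_def_field]
  exact div_nonneg_of_nonpos (by linarith) (by linarith [mem_Iio.1 hst])

section ConfRFS

variable {T : ℝ} {M : Set (ℂ × ℝ)} {u : ℂ → ℝ → ℝ}

lemma ConfRFS.contDiffAt (hRF : ConfRFS T M u) {z : ℂ} {t : ℝ} (h : (z, t) ∈ M) :
    ContDiffAt ℝ 2 (fun p : ℂ × ℝ => u p.1 p.2) (z, t) :=
  (hRF.smooth.contDiffAt (hRF.opn.mem_nhds h)).of_le (WithTop.coe_le_coe.2 (le_top : (2 : ℕ∞) ≤ ⊤))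

lemma ConfRFS.contDiffAt_space (hRF : ConfRFS T M u) {z : ℂ} {t : ℝ} (h : (z, t) ∈ M) :
    ContDiffAt ℝ 2 (fun y => u y t) z :=
  ContDiffAt.comp (f := fun y : ℂ => (y, t)) z (hRF.contDiffAt h)
    (contDiffAt_id.prodMk contDiffAt_const)

lemma ConfRFS.contDiffAt_time (hRF : ConfRFS T M u) {z : ℂ} {t : ℝ} (h : (z, t) ∈ M) :
    ContDiffAt ℝ 2 (u z) t :=
  ContDiffAt.comp (f := fun s : ℝ => (z, s)) t (hRF.contDiffAt h)
    (contDiffAt_const.prodMk contDiffAt_id)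

lemma ConfRFS.isOpen_timeSlice (hRF : ConfRFS T M u) (t : ℝ) : IsOpen (timeSlice M t) :=
  hRF.opn.preimage (by fun_prop : Continuous fun z : ℂ => (z, t))

/-- On a linearly shrinking disc that stays in the spacetime, the conformal factor stays below the
barrier `A / (ρ(t)² - |z - z₀|²)`. -/
lemma ConfRFS.mul_lt_barrier (hRF : ConfRFS T M u) {z₀ : ℂ} {r₀ t₁ R c A : ℝ}
    (hc : 0 < c) (hR : 0 < R - c * (t₁ - r₀)) (hA : 2 * R < A * c)
    (htube : ∀ t ∈ Ico r₀ t₁, ∀ z ∈ closedBall z₀ (R - c * (t - r₀)), (z, t) ∈ M)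
    (hinit : ∀ z ∈ closedBall z₀ R, u z r₀ * (R ^ 2 - ‖z - z₀‖ ^ 2) < A) :
    ∀ t ∈ Ico r₀ t₁, ∀ z ∈ closedBall z₀ (R - c * (t - r₀)),
      u z t * ((R - c * (t - r₀)) ^ 2 - ‖z - z₀‖ ^ 2) < A := by
  intro t' ht' z' hz'
  by_contra! hbad
  set ρ : ℝ → ℝ := fun t => R - c * (t - r₀) with hρ
  have hρc : Continuous ρ := by fun_prop
  have hρanti : ∀ s t, s ≤ t → ρ t ≤ ρ s := fun s t hst => by
    simp only [hρ]; nlinarith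
  set f : ℂ × ℝ → ℝ := fun p => u p.1 p.2 * (ρ p.2 ^ 2 - ‖p.1 - z₀‖ ^ 2) with hf
  set K : Set (ℂ × ℝ) := {p | p.2 ∈ Icc r₀ t' ∧ ‖p.1 - z₀‖ ≤ ρ p.2} with hK
  have hKM : K ⊆ M := fun p hp => htube p.2 ⟨hp.1.1, hp.1.2.trans_lt ht'.2⟩ p.1
    (by rw [mem_closedBall, dist_eq_norm]; exact hp.2)
  have hKcl : IsClosed K :=
    (isClosed_Icc.preimage continuous_snd).inter
      (isClosed_le (by fun_prop : Continuous fun p : ℂ × ℝ => ‖p.1 - z₀‖) (hρc.comp continuous_snd))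
  have hKc : IsCompact K := by
    refine ((isCompact_closedBall z₀ R).prod (isCompact_Icc (a := r₀) (b := t'))).of_isClosed_subset
      hKcl fun p hp => ⟨?_, hp.1⟩
    rw [mem_closedBall, dist_eq_norm]
    refine hp.2.trans ((hρanti r₀ p.2 hp.1.1).trans ?_)
    simp [hρ]
  have hfat : ∀ p ∈ M, ContinuousAt f p := fun p hp =>
    (hRF.contDiffAt hp).continuousAt.mul (by fun_prop)
  have hfK : ContinuousOn f K := fun p hp => (hfat p (hKM hp)).continuousWithinAt
  have hScompact : IsCompact (K ∩ f ⁻¹' Ici A) :=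
    hKc.of_isClosed_subset (hfK.preimage_isClosed_of_isClosed hKcl isClosed_Ici) inter_subset_left
  obtain ⟨⟨z, t⟩, ⟨⟨⟨htr, htt'⟩, hzρ⟩, hfA⟩, hmin⟩ := hScompact.exists_isMinOn
    ⟨(z', t'), ⟨⟨⟨ht'.1, le_rfl⟩, by rw [← dist_eq_norm]; exact hz'⟩, hbad⟩⟩
    continuous_snd.continuousOn
  simp only at htr htt' hzρ
  have hbefore : ∀ y s, r₀ ≤ s → s < t → ‖y - z₀‖ ≤ ρ s → f (y, s) < A := by
    intro y s hs hst hy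
    by_contra! hcon
    exact absurd (hmin (show (y, s) ∈ K ∩ f ⁻¹' Ici A from
      ⟨⟨⟨hs, hst.le.trans htt'⟩, hy⟩, hcon⟩)) (not_le.2 hst)
  have hAf : A ≤ f (z, t) := hfA
  have hρ0 : 0 < ρ t := hR.trans_le (hρanti t t₁ (htt'.trans ht'.2.le))
  have hρR : ρ t ≤ R := (hρanti r₀ t htr).trans (by simp [hρ])
  have hA0 : 0 < A := pos_of_mul_pos_left (show 0 < A * c by linarith) hc.le
  have hrt : r₀ < t := by
    refine lt_of_le_of_ne htr fun heq => ?_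
    have h1 : ρ t = R := by simp [hρ, heq]
    have h2 := hinit z (by rw [mem_closedBall, dist_eq_norm, ← h1]; exact hzρ)
    rw [← h1, heq] at h2
    exact absurd hAf (not_le.2 h2)
  have hslice : ∀ y, ‖y - z₀‖ ≤ ρ t → (y, t) ∈ M := fun y hy => hKM ⟨⟨htr, htt'⟩, hy⟩
  have hzM := hslice z hzρ
  have hleft : ∀ y, ‖y - z₀‖ ≤ ρ t → f (y, t) ≤ A := by
    intro y hy
    have h1 : Tendsto (fun s => f (y, s)) (nhdsWithin t (Iio t)) (nhds (f (y, t))) :=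
      ((hfat _ (hslice y hy)).tendsto.comp
        (Continuous.tendsto (by fun_prop : Continuous fun s : ℝ => (y, s)) t)).mono_left
        nhdsWithin_le_nhds
    refine le_of_tendsto h1 ?_
    filter_upwards [Ico_mem_nhdsLT hrt] with s hs
    exact (hbefore y s hs.1 hs.2 (hy.trans (hρanti s t hs.2.le))).le
  have hfeq : f (z, t) = A := le_antisymm (hleft z hzρ) hAf
  set w := ρ t ^ 2 - ‖z - z₀‖ ^ 2 with hw
  have hupos := hRF.pos _ hzM
  simp only at hupos
  have huw : u z t * w = A := hfeq
  have hw0 : 0 < w := by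
    by_contra! hcon
    nlinarith
  have htime : 0 ≤ deriv (u z) t * w + u z t * (2 * ρ t * -c) := by
    have hd1 := ((hRF.contDiffAt_time hzM).differentiableAt (by simp)).hasDerivAt
    have hd2 : HasDerivAt ρ (-c) t :=
      ((((hasDerivAt_id t).sub_const r₀).const_mul c).const_sub R).congr_deriv (by simp)
    have hd3 : HasDerivAt (fun s => ρ s ^ 2 - ‖z - z₀‖ ^ 2) (2 * ρ t * -c) t :=
      ((hd2.pow 2).sub_const _).congr_deriv (by simp)
    refine (hd1.mul hd3).nonneg_of_eventually_le_left ?_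
    filter_upwards [Ico_mem_nhdsLT hrt] with s hs
    exact (hbefore z s hs.1 hs.2 (hzρ.trans (hρanti s t hs.2.le))).le.trans hAf
  have hspace : lap (fun y => Real.log (u y t)) z ≤ 4 * ρ t ^ 2 / w ^ 2 := by
    refine lap_le_of_isLocalMax ((hRF.contDiffAt_space hzM).log hupos.ne') (by linarith) ?_
    have hlt : ‖z - z₀‖ < ρ t := lt_of_pow_lt_pow_left₀ 2 hρ0.le (by linarith)
    have hnear : ∀ᶠ y in nhds z, ‖y - z₀‖ < ρ t :=
      (by fun_prop : ContinuousAt (fun y : ℂ => ‖y - z₀‖) z).eventually (gt_mem_nhds hlt)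
    filter_upwards [hnear] with y hy
    have hyp := hRF.pos _ (hslice y hy.le)
    simp only at hyp
    have hwy : 0 < ρ t ^ 2 - ‖y - z₀‖ ^ 2 := by
      nlinarith [norm_nonneg (y - z₀)]
    rw [← Real.log_mul hyp.ne' hwy.ne', ← Real.log_mul hupos.ne' hw0.ne', huw]
    exact Real.log_le_log (by positivity) (hleft y hy.le)
  rw [hRF.lfde _ hzM] at htime
  rw [le_div_iff₀ (by positivity)] at hspace
  have h1 : 2 * c * ρ t * A ≤ 4 * ρ t ^ 2 := by
    have := mul_le_mul_of_nonneg_right htime hw0.le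
    rw [← huw]
    nlinarith
  have h2 : c * A ≤ 2 * ρ t := by
    by_contra! hcon
    nlinarith
  linarith

/-- A disc in a time-slice of a complete spacetime persists, up to an arbitrarily small loss of
radius, for as long as its centre does. -/
lemma ConfRFS.disc_persists (hRF : ConfRFS T M u) (hcomp : ConfRFSComplete T M u) {z₀ : ℂ}
    {r₀ r₁ R ρ₁ : ℝ} (hr : r₀ < r₁) (hcenter : ∀ t ∈ Icc r₀ r₁, (z₀, t) ∈ M)
    (hball : ∀ z ∈ closedBall z₀ R, (z, r₀) ∈ M) (hρ₁ : 0 < ρ₁) (hR : ρ₁ < R) :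
    ∀ z ∈ closedBall z₀ ρ₁, ∀ t ∈ Icc r₀ r₁, (z, t) ∈ M := by
  set c := (R - ρ₁) / (r₁ - r₀) with hc
  have hc0 : 0 < c := div_pos (by linarith) (by linarith)
  have hcr : c * (r₁ - r₀) = R - ρ₁ := div_mul_cancel₀ _ (by linarith)
  set ρ : ℝ → ℝ := fun t => R - c * (t - r₀) with hρ
  have hρc : Continuous ρ := by fun_prop
  have hρanti : ∀ s t, s ≤ t → ρ t ≤ ρ s := fun s t hst => by
    simp only [hρ]; nlinarith
  have hρr₀ : ρ r₀ = R := by simp [hρ]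
  have hρr₁ : ρ r₁ = ρ₁ := by simp only [hρ]; linarith
  set K : Set (ℂ × ℝ) := {p | p.2 ∈ Icc r₀ r₁ ∧ ‖p.1 - z₀‖ ≤ ρ p.2} with hK
  suffices hKM : K ⊆ M by
    intro z hz t ht
    rw [mem_closedBall, dist_eq_norm] at hz
    exact hKM ⟨ht, hz.trans (hρr₁ ▸ hρanti t r₁ ht.2)⟩
  have hKcl : IsClosed K :=
    (isClosed_Icc.preimage continuous_snd).inter
      (isClosed_le (by fun_prop : Continuous fun p : ℂ × ℝ => ‖p.1 - z₀‖) (hρc.comp continuous_snd))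
  have hKc : IsCompact K := by
    refine ((isCompact_closedBall z₀ R).prod (isCompact_Icc (a := r₀) (b := r₁))).of_isClosed_subset
      hKcl fun p hp => ⟨?_, hp.1⟩
    rw [mem_closedBall, dist_eq_norm]
    exact hp.2.trans (hρr₀ ▸ hρanti r₀ p.2 hp.1.1)
  by_contra hnot
  obtain ⟨p, hpK, hpM⟩ := not_subset.1 hnot
  obtain ⟨⟨z₁, t₁⟩, ⟨⟨ht₁, hz₁⟩, hz₁M⟩, hmin⟩ :=
    (hKc.diff hRF.opn).exists_isMinOn ⟨p, hpK, hpM⟩ continuous_snd.continuousOn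
  simp only at ht₁ hz₁
  have htube : ∀ t ∈ Ico r₀ t₁, ∀ z ∈ closedBall z₀ (ρ t), (z, t) ∈ M := by
    intro t ht z hz
    rw [mem_closedBall, dist_eq_norm] at hz
    by_contra hcon
    exact absurd (hmin (show (z, t) ∈ K \ M from ⟨⟨⟨ht.1, ht.2.le.trans ht₁.2⟩, hz⟩, hcon⟩))
      (not_le.2 ht.2)
  have hrt : r₀ < t₁ := by
    refine lt_of_le_of_ne ht₁.1 fun heq => hz₁M ?_
    rw [← heq]
    refine hball z₁ ?_
    rwa [mem_closedBall, dist_eq_norm, ← hρr₀, heq]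
  have hρt₁ : 0 < ρ t₁ := hρ₁.trans_le (hρr₁ ▸ hρanti t₁ r₁ ht₁.2)
  obtain ⟨B, hB⟩ := ((isCompact_closedBall z₀ R).bddAbove_image
    (f := fun z => u z r₀ * (R ^ 2 - ‖z - z₀‖ ^ 2)) (fun z hz =>
      ((hRF.contDiffAt_space (hball z hz)).continuousAt.mul
        (by fun_prop)).continuousWithinAt))
  set A := max B (2 * R / c) + 1 with hA
  have hAB : B < A := (le_max_left _ _).trans_lt (lt_add_one _)
  have hAc : 2 * R < A * c := by
    rw [← div_lt_iff₀ hc0]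
    exact (le_max_right _ _).trans_lt (lt_add_one _)
  have hbar := hRF.mul_lt_barrier hc0 hρt₁ hAc htube
    (fun z hz => (hB (mem_image_of_mem _ hz)).trans_lt hAB)
  have hslice : ∀ z, ‖z - z₀‖ ≤ ρ t₁ → (z, t₁) ∈ M →
      u z t₁ * (ρ t₁ ^ 2 - ‖z - z₀‖ ^ 2) ≤ A := by
    intro z hz hzM
    have h1 : Tendsto (fun s => u z s * (ρ s ^ 2 - ‖z - z₀‖ ^ 2)) (nhdsWithin t₁ (Iio t₁))
        (nhds (u z t₁ * (ρ t₁ ^ 2 - ‖z - z₀‖ ^ 2))) :=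
      ((hRF.contDiffAt_time hzM).continuousAt.mul (by fun_prop)).tendsto.mono_left
        nhdsWithin_le_nhds
    refine le_of_tendsto h1 ?_
    filter_upwards [Ico_mem_nhdsLT hrt] with s hs
    refine (hbar s hs z ?_).le
    rw [mem_closedBall, dist_eq_norm]
    exact hz.trans (hρanti s t₁ hs.2.le)
  have hopen := hRF.isOpen_timeSlice t₁
  have hray : Continuous fun s : ℝ => z₀ + s • (z₁ - z₀) := by fun_prop
  obtain ⟨σ, ⟨hσ, hσM⟩, hσmin⟩ :=
    (isCompact_Icc.inter_right (hopen.isClosed_compl.preimage hray)).exists_isLeast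
    (s := Icc (0:ℝ) 1 ∩ (fun s : ℝ => z₀ + s • (z₁ - z₀)) ⁻¹' (timeSlice M t₁)ᶜ)
    ⟨1, by simp, by simpa [timeSlice] using hz₁M⟩
  have hσ0 : 0 < σ := by
    refine lt_of_le_of_ne hσ.1 fun heq => hσM ?_
    simpa [← heq, timeSlice] using hcenter t₁ ht₁
  set e := σ • (z₁ - z₀) with he
  have hpt : ∀ q : ℝ, z₀ + σ • (z₁ - z₀) - (q ^ 2) • e = z₀ + ((1 - q ^ 2) * σ) • (z₁ - z₀) := by
    intro q
    rw [he, smul_smul, sub_mul, one_mul, sub_smul, add_sub_assoc]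
  have hin : ∀ q ∈ Ioc (0:ℝ) 1, z₀ + σ • (z₁ - z₀) - (q ^ 2) • e ∈ timeSlice M t₁ := by
    intro q hq
    rw [hpt]
    by_contra hcon
    have hq2 : q ^ 2 ≤ 1 := pow_le_one₀ hq.1.le hq.2
    have hq0 : 0 < q ^ 2 := pow_pos hq.1 2
    have := hσmin ⟨⟨mul_nonneg (by linarith) hσ.1, by nlinarith [hσ.2]⟩, hcon⟩
    nlinarith
  have htT : t₁ ∈ Ioo 0 T := hRF.sub (hcenter t₁ ht₁)
  refine hσM ((hcomp t₁ htT).endpoint_mem hopen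
    (fun z hz => (hRF.contDiffAt_space hz).continuousAt.continuousWithinAt)
    (fun z hz => hRF.pos _ hz) (e := e) (C := Real.sqrt (A / ρ t₁ ^ 2)) hin ?_)
  intro q hq
  have hmem := hin q hq
  have hq2 : q ^ 2 ≤ 1 := pow_le_one₀ hq.1.le hq.2
  have hnorm : ‖z₀ + σ • (z₁ - z₀) - (q ^ 2) • e - z₀‖ ≤ (1 - q ^ 2) * ρ t₁ := by
    rw [hpt, add_sub_cancel_left, norm_smul, Real.norm_of_nonneg
      (mul_nonneg (by linarith) hσ.1), mul_assoc]
    refine mul_le_mul_of_nonneg_left ?_ (by linarith)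
    exact (mul_le_of_le_one_left (norm_nonneg _) hσ.2).trans hz₁
  have hle : ‖z₀ + σ • (z₁ - z₀) - (q ^ 2) • e - z₀‖ ≤ ρ t₁ :=
    hnorm.trans (mul_le_of_le_one_left hρt₁.le (by linarith [sq_nonneg q]))
  have hb := hslice _ hle hmem
  have hup := hRF.pos _ hmem
  simp only at hup
  have hsqrt : Real.sqrt (u (z₀ + σ • (z₁ - z₀) - (q ^ 2) • e) t₁) * q =
      Real.sqrt (u (z₀ + σ • (z₁ - z₀) - (q ^ 2) • e) t₁ * q ^ 2) := by
    rw [Real.sqrt_mul hup.le, Real.sqrt_sq hq.1.le]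
  refine hsqrt.le.trans (Real.sqrt_le_sqrt ?_)
  rw [le_div_iff₀ (by positivity)]
  refine le_trans ?_ hb
  rw [mul_assoc]
  refine mul_le_mul_of_nonneg_left ?_ hup.le
  have hsq := pow_le_pow_left₀ (norm_nonneg _) hnorm 2
  nlinarith [mul_nonneg (mul_nonneg (sq_nonneg q) (sub_nonneg.2 hq2)) (sq_nonneg (ρ t₁))]

/-- Connected components of time-slices of a complete spacetime persist as long as one of their
points does. -/
lemma ConfRFS.component_persists (hRF : ConfRFS T M u) (hcomp : ConfRFSComplete T M u) {z₀ : ℂ}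
    {r₀ r₁ : ℝ} (hr : r₀ < r₁) (hcenter : ∀ t ∈ Icc r₀ r₁, (z₀, t) ∈ M) :
    ∀ z ∈ connectedComponentIn (timeSlice M r₀) z₀, ∀ t ∈ Icc r₀ r₁, (z, t) ∈ M := by
  set P : Set ℂ := {z | ∀ t ∈ Icc r₀ r₁, (z, t) ∈ M} with hP
  have hr₀ : r₀ ∈ Icc r₀ r₁ := left_mem_Icc.2 hr.le
  have hz₀ : z₀ ∈ timeSlice M r₀ := hcenter r₀ hr₀
  have key : ∀ z ∈ timeSlice M r₀, ∃ ε > 0, ∀ y ∈ P ∩ ball z ε, ball y ε ⊆ P := by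
    intro z hz
    obtain ⟨δ, hδ, hb⟩ := Metric.isOpen_iff.1 (hRF.isOpen_timeSlice r₀) z hz
    refine ⟨δ / 4, by positivity, fun y hy y' hy' => ?_⟩
    refine hRF.disc_persists hcomp hr hy.1 (R := δ / 2) (fun x hx => hb ?_)
      (show 0 < δ / 4 by positivity) (by linarith) y' (ball_subset_closedBall hy')
    have h1 := mem_closedBall.1 hx
    have h2 := mem_ball.1 hy.2
    exact mem_ball.2 (by linarith [dist_triangle x y z])
  have hPo : IsOpen P := by
    rw [Metric.isOpen_iff]
    intro z hz
    obtain ⟨ε, hε, h⟩ := key z (hz r₀ hr₀)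
    exact ⟨ε, hε, h z ⟨hz, mem_ball_self hε⟩⟩
  refine isPreconnected_connectedComponentIn.subset_of_closure_inter_subset hPo
    ⟨z₀, mem_connectedComponentIn hz₀, hcenter⟩ ?_
  rintro z ⟨hzcl, hzC⟩
  obtain ⟨ε, hε, h⟩ := key z (connectedComponentIn_subset _ _ hzC)
  obtain ⟨y, hyP, hzy⟩ := Metric.mem_closure_iff.1 hzcl ε hε
  exact h y ⟨hyP, by rwa [mem_ball, dist_comm]⟩ hzy

lemma ConfRFS.exists_box (hRF : ConfRFS T M u) {z : ℂ} {t : ℝ} (h : (z, t) ∈ M) :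
    ∃ ε > 0, ∀ y s, ‖y - z‖ ≤ ε → |s - t| ≤ ε → (y, s) ∈ M := by
  obtain ⟨ε, hε, hb⟩ := Metric.nhds_basis_closedBall.mem_iff.1 (hRF.opn.mem_nhds h)
  refine ⟨ε, hε, fun y s hy hs => hb ?_⟩
  rw [mem_closedBall, Prod.dist_eq, dist_eq_norm, Real.dist_eq]
  exact max_le hy hs

/-- There is a time-preserving path in `M` from `p` forward to `q`. -/
def ForwardTo (M : Set (ℂ × ℝ)) (p q : ℂ × ℝ) : Prop :=
  p.2 ≤ q.2 ∧ ∃ η : ℝ → ℂ, ContinuousOn η (Icc p.2 q.2) ∧ (∀ r ∈ Icc p.2 q.2, (η r, r) ∈ M) ∧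
    η p.2 = p.1 ∧ η q.2 = q.1

lemma ForwardTo.trans {p q r : ℂ × ℝ} (h₁ : ForwardTo M p q) (h₂ : ForwardTo M q r) :
    ForwardTo M p r := by
  obtain ⟨hpq, η₁, hc₁, hM₁, hp, hq⟩ := h₁
  obtain ⟨hqr, η₂, hc₂, hM₂, hq', hr⟩ := h₂
  refine ⟨hpq.trans hqr, fun s => if s ≤ q.2 then η₁ s else η₂ s, ?_, ?_, by simp [hpq, hp], ?_⟩
  · refine ContinuousOn.if ?_ ?_ ?_
    · rintro a ⟨-, ha⟩
      have ha' : a = q.2 := frontier_le_subset_eq continuous_id continuous_const ha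
      rw [ha', hq, hq']
    · refine hc₁.mono ?_
      rintro s ⟨hs, hs'⟩
      rw [(isClosed_le continuous_id continuous_const : IsClosed {a : ℝ | a ≤ q.2}).closure_eq]
        at hs'
      exact ⟨hs.1, hs'⟩
    · refine hc₂.mono ?_
      rintro s ⟨hs, hs'⟩
      have hs'' : s ∈ Ici q.2 :=
        closure_minimal (fun a ha => (not_le.1 ha).le) isClosed_Ici hs'
      exact ⟨hs'', hs.2⟩
  · intro s hs
    by_cases h : s ≤ q.2
    · simpa only [h, if_true] using hM₁ s ⟨hs.1, h⟩
    · simpa only [h, if_false] using hM₂ s ⟨(not_le.1 h).le, hs.2⟩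
  · by_cases h : r.2 ≤ q.2
    · have heq : r.2 = q.2 := le_antisymm h hqr
      simp only [h, if_true]
      rw [heq, hq, ← hq', ← heq, hr]
    · simp only [h, if_false, hr]

lemma ForwardTo.of_path {η : ℝ → ℂ} {s t a b : ℝ} (hη : ContinuousOn η (Icc s t))
    (hM : ∀ r ∈ Icc s t, (η r, r) ∈ M) (hsa : s ≤ a) (hab : a ≤ b) (hbt : b ≤ t) :
    ForwardTo M (η a, a) (η b, b) :=
  ⟨hab, η, hη.mono (Icc_subset_Icc hsa hbt), fun r hr => hM r ⟨hsa.trans hr.1, hr.2.trans hbt⟩,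
    rfl, rfl⟩

/-- Inside a component of a time-slice one can move to any given time-preserving path
in arbitrarily short time. -/
lemma ConfRFS.exists_forwardTo_path (hRF : ConfRFS T M u) {a b : ℂ} {t t' : ℝ} (htt' : t < t')
    (hb : b ∈ connectedComponentIn (timeSlice M t) a) {β : ℝ → ℂ} (hβ : ContinuousOn β (Icc t t'))
    (hβt : β t = b) : ∃ r ∈ Ioc t t', ForwardTo M (a, t) (β r, r) := by
  have ha : a ∈ timeSlice M t := by
    by_contra h
    rw [connectedComponentIn_eq_empty h] at hb
    exact hb
  obtain ⟨γ, hγ, hγM, h0, h1⟩ := exists_contDiff_path (hRF.isOpen_timeSlice t) ha hb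
  have hKc : IsCompact ((fun s => (γ s, t)) '' Icc (0:ℝ) 1) :=
    isCompact_Icc.image (hγ.continuous.prodMk continuous_const)
  obtain ⟨δ, hδ, hsub⟩ := hKc.exists_cthickening_subset_open hRF.opn
    (by rintro _ ⟨s, -, rfl⟩; exact hγM s)
  obtain ⟨κ, hκ, hκβ⟩ := Metric.continuousWithinAt_iff.1 (hβ t (left_mem_Icc.2 htt'.le)) δ hδ
  set r := min t' (t + min (κ / 2) δ) with hr
  have htr : t < r := lt_min htt' (by linarith [show 0 < min (κ / 2) δ by positivity])
  have hrt' : r ≤ t' := min_le_left _ _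
  have hrδ : r - t ≤ min (κ / 2) δ := by linarith [min_le_right t' (t + min (κ / 2) δ)]
  refine ⟨r, ⟨htr, hrt'⟩, htr.le,
    fun s => γ ((s - t) / (r - t)) + (β s - β t), ?_, ?_, ?_, ?_⟩
  · exact (hγ.continuous.comp (by fun_prop)).continuousOn.add
      ((hβ.mono (Icc_subset_Icc_right hrt')).sub continuousOn_const)
  · intro s hs
    simp only at hs
    have hmem : (s - t) / (r - t) ∈ Icc (0:ℝ) 1 :=
      ⟨div_nonneg (by linarith [hs.1]) (by linarith),
        (div_le_one (by linarith)).2 (by linarith [hs.2])⟩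
    refine hsub (Metric.mem_cthickening_of_dist_le _ _ δ _ (mem_image_of_mem _ hmem) ?_)
    rw [Prod.dist_eq, max_le_iff]
    constructor
    · have := hκβ ⟨hs.1, hs.2.trans hrt'⟩ (by
        rw [Real.dist_eq, abs_of_nonneg (by linarith [hs.1])]
        linarith [hs.2, min_le_left (κ / 2) δ])
      rw [dist_eq_norm] at this ⊢
      simpa using this.le
    · rw [Real.dist_eq, abs_of_nonneg (by linarith [hs.1])]
      linarith [hs.2, min_le_right (κ / 2) δ]
  · simp [h0]
  · have : r - t ≠ 0 := by linarith
    simp only [div_self this, h1, hβt]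
    ring

/-- Time-preserving paths starting at the same point stay in the same component of the
time-slices of a complete spacetime. -/
lemma ConfRFS.mem_component_of_paths (hRF : ConfRFS T M u) (hcomp : ConfRFSComplete T M u)
    {s t : ℝ} (hst : s ≤ t) {α β : ℝ → ℂ} (hα : ContinuousOn α (Icc s t))
    (hβ : ContinuousOn β (Icc s t)) (hαM : ∀ r ∈ Icc s t, (α r, r) ∈ M)
    (hβM : ∀ r ∈ Icc s t, (β r, r) ∈ M) (h0 : α s = β s) :
    β t ∈ connectedComponentIn (timeSlice M t) (α t) := by
  have near : ∀ {η : ℝ → ℂ}, ContinuousOn η (Icc s t) → (∀ r ∈ Icc s t, (η r, r) ∈ M) →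
      ∀ r ∈ Icc s t, ∃ ε > 0, (∀ y r', ‖y - η r‖ ≤ ε → |r' - r| ≤ ε → (y, r') ∈ M) ∧
        ∃ δ > 0, ∀ r' ∈ Icc s t, |r' - r| ≤ δ → ‖η r' - η r‖ ≤ ε := by
    intro η hη hηM r hr
    obtain ⟨ε, hε, hbox⟩ := hRF.exists_box (hηM r hr)
    obtain ⟨δ, hδ, h⟩ := Metric.continuousWithinAt_iff.1 (hη r hr) ε hε
    refine ⟨ε, hε, hbox, δ / 2, by positivity, fun r' hr' hd => ?_⟩
    rw [← dist_eq_norm]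
    exact (h hr' (by rw [Real.dist_eq]; linarith)).le
  set S : Set ℝ := {r | β r ∈ connectedComponentIn (timeSlice M r) (α r)} with hS
  have hmem : ∀ {r : ℝ} {C : Set ℂ}, IsPreconnected C → C ⊆ timeSlice M r → α r ∈ C → β r ∈ C →
      r ∈ S := fun hC hCM ha hb => hC.subset_connectedComponentIn ha hCM hb
  have hright : ∀ r ∈ Ico s t, r ∈ S → ∃ δ > 0, ∀ r' ∈ Icc s t, |r' - r| ≤ δ → r' ∈ S := by
    intro r hr hrS
    have hr' := Ico_subset_Icc_self hr
    obtain ⟨ε₁, hε₁, hbox₁, δ₁, hδ₁, hn₁⟩ := near hα hαM r hr'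
    obtain ⟨ε₂, hε₂, hbox₂, δ₂, hδ₂, hn₂⟩ := near hβ hβM r hr'
    obtain ⟨γ, hγ, hγM, hγ0, hγ1⟩ := exists_contDiff_path (hRF.isOpen_timeSlice r) (hαM r hr') hrS
    have hKc : IsCompact ((fun x => (γ x, r)) '' Icc (0:ℝ) 1) :=
      isCompact_Icc.image (hγ.continuous.prodMk continuous_const)
    obtain ⟨δ₃, hδ₃, hsub⟩ := hKc.exists_cthickening_subset_open hRF.opn
      (by rintro _ ⟨x, -, rfl⟩; exact hγM x)
    refine ⟨min (min (min ε₁ δ₁) (min ε₂ δ₂)) δ₃, by positivity, fun q hq hqr => ?_⟩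
    simp only [le_min_iff] at hqr
    obtain ⟨⟨⟨he₁, hd₁⟩, he₂, hd₂⟩, hd₃⟩ := hqr
    have hγa : α r ∈ γ '' Icc (0:ℝ) 1 := ⟨0, by simp, hγ0⟩
    have hγb : β r ∈ γ '' Icc (0:ℝ) 1 := ⟨1, by simp, hγ1⟩
    have hC : IsPreconnected ((γ '' Icc (0:ℝ) 1 ∪ closedBall (α r) ε₁) ∪ closedBall (β r) ε₂) :=
      ((isPreconnected_Icc.image γ hγ.continuous.continuousOn).union (α r) hγa
        (mem_closedBall_self hε₁.le) (convex_closedBall _ _).isPreconnected).union (β r)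
        (Or.inl hγb) (mem_closedBall_self hε₂.le) (convex_closedBall _ _).isPreconnected
    refine hmem hC ?_ (Or.inl (Or.inr ?_)) (Or.inr ?_)
    · rintro y ((⟨x, hx, rfl⟩ | hy) | hy)
      · refine hsub (Metric.mem_cthickening_of_dist_le _ _ δ₃ _ (mem_image_of_mem _ hx) ?_)
        rw [Prod.dist_eq, max_le_iff]
        simp only [dist_self]
        exact ⟨hδ₃.le, hd₃⟩
      · exact hbox₁ y q (by rwa [← dist_eq_norm]) he₁
      · exact hbox₂ y q (by rwa [← dist_eq_norm]) he₂
    · rw [mem_closedBall, dist_eq_norm]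
      exact hn₁ q hq hd₁
    · rw [mem_closedBall, dist_eq_norm]
      exact hn₂ q hq hd₂
  have hleft : ∀ r ∈ Ioc s t, (∀ q ∈ Ico s r, q ∈ S) → r ∈ S := by
    intro r hr hrS
    have hr' := Ioc_subset_Icc_self hr
    obtain ⟨ε₁, hε₁, hbox₁, δ₁, hδ₁, hn₁⟩ := near hα hαM r hr'
    obtain ⟨ε₂, hε₂, hbox₂, δ₂, hδ₂, hn₂⟩ := near hβ hβM r hr'
    set d := min (min (min ε₁ δ₁) (min ε₂ δ₂)) (r - s) with hd
    have hd0 : 0 < d := by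
      have : 0 < r - s := by linarith [hr.1]
      positivity
    have hds : d ≤ min (min (min ε₁ δ₁) (min ε₂ δ₂)) (r - s) := le_rfl
    simp only [le_min_iff] at hds
    obtain ⟨⟨⟨he₁, hd₁⟩, he₂, hd₂⟩, hdr⟩ := hds
    set q := r - d with hq
    have hqI : q ∈ Ico s r := ⟨by linarith, by linarith⟩
    have hqI' : q ∈ Icc s t := ⟨hqI.1, hqI.2.le.trans hr.2⟩
    have hqr : |q - r| = d := by rw [hq, sub_sub_cancel_left, abs_neg, abs_of_pos hd0]
    have habs : ∀ x ∈ Icc q r, |x - r| ≤ d := fun x hx => by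
      rw [abs_le]; exact ⟨by linarith [hx.1], by linarith [hx.2]⟩
    have hqM : q ∈ Icc q r := left_mem_Icc.2 hqI.2.le
    have hpers := hRF.component_persists hcomp (z₀ := α r) hqI.2
      (fun x hx => hbox₁ _ _ (by simpa using hε₁.le) ((habs x hx).trans he₁))
    have hballα : closedBall (α r) ε₁ ⊆ connectedComponentIn (timeSlice M q) (α r) :=
      (convex_closedBall _ _).isPreconnected.subset_connectedComponentIn
        (mem_closedBall_self hε₁.le) fun y hy =>
          hbox₁ y q (by rwa [← dist_eq_norm]) (hqr.le.trans he₁)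
    have hαq : α q ∈ connectedComponentIn (timeSlice M q) (α r) := hballα (by
      rw [mem_closedBall, dist_eq_norm]; exact hn₁ q hqI' (hqr.le.trans hd₁))
    have hβq : β q ∈ connectedComponentIn (timeSlice M q) (α r) := by
      rw [connectedComponentIn_eq hαq]; exact hrS q hqI
    have hballβ : closedBall (β r) ε₂ ⊆ connectedComponentIn (timeSlice M q) (α r) := by
      rw [connectedComponentIn_eq hβq]
      refine (convex_closedBall _ _).isPreconnected.subset_connectedComponentIn ?_ fun y hy =>
        hbox₂ y q (by rwa [← dist_eq_norm]) (hqr.le.trans he₂)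
      rw [mem_closedBall, dist_eq_norm]
      exact hn₂ q hqI' (hqr.le.trans hd₂)
    exact hmem isPreconnected_connectedComponentIn
      (fun y hy => hpers y hy r (right_mem_Icc.2 hqI.2.le))
      (hballα (mem_closedBall_self hε₁.le)) (hballβ (mem_closedBall_self hε₂.le))
  by_contra hnot
  have hbad : (Icc s t \ S).Nonempty := ⟨t, right_mem_Icc.2 hst, hnot⟩
  have hbdd : BddBelow (Icc s t \ S) := ⟨s, fun r hr => hr.1.1⟩
  set m := sInf (Icc s t \ S) with hm
  have hsm : s ≤ m := le_csInf hbad fun r hr => hr.1.1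
  have hmt : m ≤ t := csInf_le hbdd ⟨right_mem_Icc.2 hst, hnot⟩
  have hbefore : ∀ q ∈ Ico s m, q ∈ S := fun q hq => by
    by_contra hqS
    exact absurd (csInf_le hbdd ⟨⟨hq.1, hq.2.le.trans hmt⟩, hqS⟩) (not_le.2 hq.2)
  have hmS : m ∈ S := by
    rcases hsm.eq_or_lt with h | h
    · rw [← h]
      exact hmem isPreconnected_singleton (C := {α s})
        (singleton_subset_iff.2 (hαM s (left_mem_Icc.2 hst))) rfl h0.symm
    · exact hleft m ⟨h, hmt⟩ hbefore
  have hmt' : m < t := lt_of_le_of_ne hmt fun h => hnot (h ▸ hmS)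
  obtain ⟨δ, hδ, hδS⟩ := hright m ⟨hsm, hmt'⟩ hmS
  obtain ⟨q, hq, hqδ⟩ := exists_lt_of_csInf_lt hbad (show sInf (Icc s t \ S) < m + δ by linarith)
  refine hq.2 (hδS q hq.1 ?_)
  rw [abs_of_nonneg (by linarith [csInf_le hbdd hq])]
  linarith

/-- Points reached from a common point are joined by a forward tent. -/
lemma ConfRFS.exists_forwardTo_of_fork (hRF : ConfRFS T M u) (hcomp : ConfRFSComplete T M u)
    {p a b : ℂ × ℝ} (ha : ForwardTo M p a) (hb : ForwardTo M p b) :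
    ∃ q, ForwardTo M a q ∧ ForwardTo M b q := by
  wlog hab : a.2 ≤ b.2 generalizing a b
  · obtain ⟨q, h1, h2⟩ := this hb ha (le_of_not_ge hab)
    exact ⟨q, h2, h1⟩
  have hbM : (b.1, b.2) ∈ M := by
    obtain ⟨h, β, -, hM, -, h1⟩ := hb
    exact h1 ▸ hM b.2 (right_mem_Icc.2 h)
  obtain ⟨ε, hε, hbox⟩ := hRF.exists_box hbM
  have hbc : ForwardTo M b (b.1, b.2 + ε) := by
    refine ⟨by simp [hε.le], fun _ => b.1, continuousOn_const, fun r hr => ?_, rfl, rfl⟩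
    refine hbox _ _ (by simpa using hε.le) ?_
    rw [abs_of_nonneg (by linarith [hr.1])]
    linarith [hr.2]
  obtain ⟨hpa, α, hα, hαM, hα0, hα1⟩ := ha
  obtain ⟨hpc, β, hβ, hβM, hβ0, hβ1⟩ := hb.trans hbc
  simp only at hpc hβ hβM hβ1
  have hac : a.2 < b.2 + ε := by linarith
  have hsub : Icc p.2 a.2 ⊆ Icc p.2 (b.2 + ε) := Icc_subset_Icc_right hac.le
  have hcc := hRF.mem_component_of_paths hcomp hpa hα (hβ.mono hsub) hαM
    (fun r hr => hβM r (hsub hr)) (hα0.trans hβ0.symm)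
  rw [hα1] at hcc
  obtain ⟨r, hr, hfr⟩ := hRF.exists_forwardTo_path hac hcc
    (hβ.mono (Icc_subset_Icc_left hpa)) rfl
  refine ⟨_, hfr.trans (.of_path hβ hβM (hpa.trans hr.1.le) hr.2 le_rfl), ?_⟩
  rw [hβ1]
  exact hbc

/-- Nearby points are joined by a forward tent. -/
lemma ConfRFS.eventually_exists_forwardTo (hRF : ConfRFS T M u) {p : ℂ × ℝ} (hp : p ∈ M) :
    ∀ᶠ p' in nhdsWithin p M, ∃ q, ForwardTo M p q ∧ ForwardTo M p' q := by
  obtain ⟨ε, hε, hbox⟩ := hRF.exists_box (show (p.1, p.2) ∈ M from hp)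
  have hsegment : ∀ p' ∈ ball p ε, ForwardTo M p' (p.1, p.2 + ε) := by
    intro p' hp'
    rw [mem_ball, Prod.dist_eq, max_lt_iff, dist_eq_norm, Real.dist_eq, abs_lt] at hp'
    obtain ⟨h1, h2, h3⟩ := hp'
    have hlt : 0 < p.2 + ε - p'.2 := by linarith
    refine ⟨by simp only; linarith,
      fun r => p'.1 + ((r - p'.2) / (p.2 + ε - p'.2)) • (p.1 - p'.1), by fun_prop, ?_, by simp, ?_⟩
    · intro r hr
      simp only at hr
      refine hbox _ _ ?_ (abs_le.2 ⟨by linarith [hr.1], by linarith [hr.2]⟩)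
      have := (convex_closedBall p.1 ε).add_smul_sub_mem (x := p'.1) (y := p.1)
        (by rw [mem_closedBall, dist_eq_norm]; exact h1.le) (mem_closedBall_self hε.le)
        (t := (r - p'.2) / (p.2 + ε - p'.2))
        ⟨div_nonneg (by linarith [hr.1]) hlt.le, (div_le_one hlt).2 (by linarith [hr.2])⟩
      rwa [mem_closedBall, dist_eq_norm] at this
    · simp only [div_self hlt.ne', one_smul, add_sub_cancel]
  exact nhdsWithin_le_nhds (Filter.mem_of_superset (ball_mem_nhds p hε)
    fun p' hp' => ⟨_, hsegment p (mem_ball_self hε), hsegment p' hp'⟩)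

end ConfRFS

/-- Any two points of a complete conformal Ricci flow spacetime are joined by a
single forward 'tent' of time-preserving paths. -/
theorem joined_by_forward_tent
    (T : ℝ) (hT : 0 < T) (M : Set (ℂ × ℝ)) (u : ℂ → ℝ → ℝ)
    (hRF : ConfRFS T M u) (hcomp : ConfRFSComplete T M u) :
    ∀ (x : ℂ) (t : ℝ) (x' : ℂ) (t' : ℝ), (x, t) ∈ M → (x', t') ∈ M →
      ∃ (y : ℂ) (τ : ℝ), (y, τ) ∈ M ∧ max t t' ≤ τ ∧
        ∃ η γ : ℝ → ℂ,
          ContinuousOn η (Icc t τ) ∧ ContinuousOn γ (Icc t' τ) ∧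
          (∀ r ∈ Icc t τ, (η r, r) ∈ M) ∧ (∀ r ∈ Icc t' τ, (γ r, r) ∈ M) ∧
          η t = x ∧ γ t' = x' ∧ η τ = y ∧ γ τ = y := by
  intro x t x' t' hx hx'
  obtain ⟨⟨y, τ⟩, ⟨htτ, η, hη, hηM, hη0, hη1⟩, ht'τ, γ, hγ, hγM, hγ0, hγ1⟩ :=
    hRF.conn.isPreconnected.induction₂ (fun p p' => ∃ q, ForwardTo M p q ∧ ForwardTo M p' q)
      (fun p hp => hRF.eventually_exists_forwardTo hp)
      (fun a b c _ _ _ hab hbc => by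
        obtain ⟨q₁, haq, hbq⟩ := hab
        obtain ⟨q₂, hbq', hcq⟩ := hbc
        obtain ⟨q, h1, h2⟩ := hRF.exists_forwardTo_of_fork hcomp hbq hbq'
        exact ⟨q, haq.trans h1, hcq.trans h2⟩)
      (fun a b _ _ hab => by
        obtain ⟨q, h1, h2⟩ := hab
        exact ⟨q, h2, h1⟩) hx hx'
  simp only at htτ ht'τ hη1 hγ1
  exact ⟨y, τ, hη1 ▸ hηM τ (right_mem_Icc.2 htτ), max_le htτ ht'τ, η, γ, hη, hγ, hηM, hγM,
    hη0, hγ0, hη1, hγ1⟩
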